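/- arXiv:2504.06700 — 2 statements merged into one kernel-verified Lean document; each statement's English description precedes it below -/
import Mathlib

section
/- For every instance of hierarchical correlation clustering (finite set V, ℓ ≥ 1 layers with nonnegative weights δ_1,…,δ_ℓ and edge-pair sets E^(1),…,E^(ℓ)), there exists a consistent collection of partitions P^(1),…,P^(ℓ) of V (each P^(t) refines P^(t+1)) whose weighted number of disagreements Σ_{t=1}^ℓ δ_t · #(P^(t)) is at most 25.7846 times the minimum objective value of LP-(*) over all feasible fractional solutions; in particular, since every consistent hierarchical clustering induces a feasible LP-(*) solution of the same objective value, it is at most 25.7846 times the optimal weighted number of disagreements. -/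
open Finset
open scoped Classical

/-- Both endpoints of the unordered pair `e` lie in the same cluster of the
clustering described by the relation `R`. -/
def PairTogether {V : Type*} (R : V → V → Prop) (e : Sym2 V) : Prop :=
  ∃ u v, e = s(u, v) ∧ R u v

/-- Feasibility for LP-(*): each layer `t ∈ {1,…,ℓ}` carries a `[0,1]`-valued
function on unordered pairs (vanishing on the diagonal) satisfying the
triangle inequality, and the values are monotone non-increasing bottom-up. -/
def LPStarFeasible {V : Type*} (ℓ : ℕ) (x : ℕ → Sym2 V → ℝ) : Prop :=
  (∀ t ∈ Finset.Icc 1 ℓ, ∀ u : V, x t s(u, u) = 0) ∧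
  (∀ t ∈ Finset.Icc 1 ℓ, ∀ u v p : V, x t s(u, v) ≤ x t s(u, p) + x t s(p, v)) ∧
  (∀ t ∈ Finset.Icc 1 ℓ, ∀ e : Sym2 V, 0 ≤ x t e ∧ x t e ≤ 1) ∧
  (∀ t, 1 ≤ t → t < ℓ → ∀ e : Sym2 V, x (t + 1) e ≤ x t e)

/-- The objective value of LP-(*):
`Σ_t δ_t (Σ_{e ∈ E^(t)} x^(t)_e + Σ_{e ∈ NE^(t)} (1 − x^(t)_e))`,
where `NE^(t)` is the set of non-diagonal pairs not in `E^(t)`. -/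
noncomputable def LPStarVal {V : Type*} [Fintype V] [DecidableEq V]
    (ℓ : ℕ) (δ : ℕ → ℝ) (E : ℕ → Finset (Sym2 V)) (x : ℕ → Sym2 V → ℝ) : ℝ :=
  ∑ t ∈ Finset.Icc 1 ℓ, δ t *
    ((∑ e ∈ E t, x t e) +
      ∑ e ∈ Finset.univ.filter (fun e : Sym2 V => ¬ e.IsDiag) \ E t, (1 - x t e))

/-- The weighted number of disagreements `Σ_t δ_t · #(P^(t))` of the hierarchical
clustering described by the equivalence relations `R t`: at each layer, non-edge
pairs clustered together plus edge pairs separated. -/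
noncomputable def ClusCost {V : Type*} [Fintype V]
    (ℓ : ℕ) (δ : ℕ → ℝ) (E : ℕ → Finset (Sym2 V)) (R : ℕ → V → V → Prop) : ℝ :=
  ∑ t ∈ Finset.Icc 1 ℓ, δ t *
    ((({e : Sym2 V | ¬ e.IsDiag ∧ e ∉ E t ∧ PairTogether (R t) e}).ncard : ℝ) +
      (({e : Sym2 V | e ∈ E t ∧ ¬ PairTogether (R t) e}).ncard : ℝ))

/-- The sum of `x u v` over the rectangle `P × Q`. -/
noncomputable def rectSum {V : Type*} (x : V → V → ℝ) (P Q : Finset V) : ℝ :=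
  ∑ u ∈ P, ∑ v ∈ Q, x u v

/-- The average of `x u v` over the rectangle `P × Q`. -/
noncomputable def rectAvg {V : Type*} (x : V → V → ℝ) (P Q : Finset V) : ℝ :=
  rectSum x P Q / ((P.card : ℝ) * Q.card)

/-- Finite sets that average linkage with threshold `γ` can produce: starting from singletons,
two disjoint sets may be merged when their average distance is at most `γ`. -/
inductive AverageLinked {V : Type*} [DecidableEq V] (γ : ℝ) (x : V → V → ℝ) : Finset V → Prop
  | single (v : V) : AverageLinked γ x {v}
  | union {P Q : Finset V} (hP : AverageLinked γ x P) (hQ : AverageLinked γ x Q)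
      (hdisj : Disjoint P Q) (hsum : rectSum x P Q ≤ γ * (P.card * Q.card)) :
      AverageLinked γ x (P ∪ Q)

/-- Pseudometrics on `V` with values in the unit interval. -/
structure UnitPseudometric {V : Type*} (x : V → V → ℝ) : Prop where
  self (u : V) : x u u = 0
  symm (u v : V) : x u v = x v u
  triangle (u v p : V) : x u v ≤ x u p + x p v
  nonneg (u v : V) : 0 ≤ x u v
  le_one (u v : V) : x u v ≤ 1

section Rectangles

variable {V : Type*} [DecidableEq V] {γ : ℝ} {x : V → V → ℝ} {P Q : Finset V}

theorem rectSum_union_left (x : V → V → ℝ) {P₁ P₂ : Finset V} (h : Disjoint P₁ P₂)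
    (Q : Finset V) : rectSum x (P₁ ∪ P₂) Q = rectSum x P₁ Q + rectSum x P₂ Q :=
  Finset.sum_union h

theorem rectSum_union_right (x : V → V → ℝ) (P : Finset V) {Q₁ Q₂ : Finset V}
    (h : Disjoint Q₁ Q₂) : rectSum x P (Q₁ ∪ Q₂) = rectSum x P Q₁ + rectSum x P Q₂ := by
  simp only [rectSum, Finset.sum_union h, Finset.sum_add_distrib]

theorem rectSum_comm {V : Type*} {x : V → V → ℝ} (hx : ∀ u v, x u v = x v u) (P Q : Finset V) :
    rectSum x P Q = rectSum x Q P := by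
  unfold rectSum
  rw [Finset.sum_comm]
  exact Finset.sum_congr rfl fun u _ => Finset.sum_congr rfl fun v _ => hx _ _

theorem AverageLinked.card_pos (h : AverageLinked γ x P) : (0 : ℝ) < P.card := by
  suffices P.Nonempty by exact_mod_cast this.card_pos
  induction h with
  | single v => exact Finset.singleton_nonempty v
  | union _ _ _ _ ih _ => exact ih.mono Finset.subset_union_left

theorem AverageLinked.mono {x' : V → V → ℝ} (hx : ∀ u v, x' u v ≤ x u v)
    (h : AverageLinked γ x P) : AverageLinked γ x' P := by
  induction h with
  | single v => exact .single v
  | union _ _ hd hs ih₁ ih₂ =>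
    exact .union ih₁ ih₂ hd
      ((Finset.sum_le_sum fun u _ => Finset.sum_le_sum fun v _ => hx u v).trans hs)

theorem AverageLinked.rectSum_self_le (hx : UnitPseudometric x) (hγ : 0 ≤ γ)
    (h : AverageLinked γ x P) : rectSum x P P ≤ γ * (P.card * P.card) := by
  induction h with
  | single v => simpa [rectSum, hx.self] using hγ
  | @union P Q _ _ hd hs ih₁ ih₂ =>
    rw [rectSum_union_left x hd, rectSum_union_right x _ hd, rectSum_union_right x _ hd,
      rectSum_comm hx.symm Q P, Finset.card_union_of_disjoint hd]
    push_cast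
    linarith

/-- The triangle inequality summed over three sets. -/
theorem card_mul_rectSum_le {V : Type*} {x : V → V → ℝ} (hx : UnitPseudometric x)
    (A B Q : Finset V) :
    B.card * rectSum x A Q ≤ Q.card * rectSum x A B + A.card * rectSum x B Q := by
  have h : ∑ a ∈ A, ∑ b ∈ B, ∑ q ∈ Q, x a q ≤ ∑ a ∈ A, ∑ b ∈ B, ∑ q ∈ Q, (x a b + x b q) :=
    Finset.sum_le_sum fun a _ => Finset.sum_le_sum fun b _ => Finset.sum_le_sum fun q _ =>
      hx.triangle a q b
  simp only [Finset.sum_add_distrib, Finset.sum_const, nsmul_eq_mul, ← Finset.mul_sum] at h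
  exact h

theorem rectAvg_comm {V : Type*} {x : V → V → ℝ} (hx : UnitPseudometric x) (P Q : Finset V) :
    rectAvg x P Q = rectAvg x Q P := by
  rw [rectAvg, rectAvg, rectSum_comm hx.symm, mul_comm]

/-- Replacing a merged set by one of its two halves changes average distances by at most `γ`. -/
theorem abs_rectAvg_sub_rectAvg_union_le (hx : UnitPseudometric x) (hγ : 0 ≤ γ)
    {A B : Finset V} (hA : (0 : ℝ) < A.card) (hB : (0 : ℝ) < B.card) (hQ : (0 : ℝ) < Q.card)
    (hd : Disjoint A B) (hs : rectSum x A B ≤ γ * (A.card * B.card)) :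
    |rectAvg x A Q - rectAvg x (A ∪ B) Q| ≤ γ := by
  have h₁ := card_mul_rectSum_le hx A B Q
  have h₂ := card_mul_rectSum_le hx B A Q
  rw [rectSum_comm hx.symm B A] at h₂
  have h₃ := mul_le_mul_of_nonneg_left hs hQ.le
  unfold rectAvg
  rw [rectSum_union_left x hd, Finset.card_union_of_disjoint hd]
  push_cast
  generalize (A.card : ℝ) = a at *
  generalize (B.card : ℝ) = b at *
  generalize (Q.card : ℝ) = q at *
  generalize rectSum x A Q = s at *
  generalize rectSum x B Q = r at *
  have h₄ : s / (a * q) - (s + r) / ((a + b) * q) = (b * s - a * r) / (a * (a + b) * q) := by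
    field_simp
    ring
  have h₅ : 0 ≤ γ * (a * a * q) := by positivity
  rw [h₄, abs_div, abs_of_pos (by positivity : 0 < a * (a + b) * q),
    div_le_iff₀ (by positivity), abs_le]
  constructor <;> nlinarith

/-- To show that `Φ` has nonnegative sum on all rectangles of average-linked sets whose average
distance lies in `I`, it suffices to treat averages in a window `W` that cannot be skipped when
the merges are undone one at a time. -/
theorem rectSum_nonneg_of_window (hx : UnitPseudometric x) (hγ : 0 ≤ γ) {I W : Set ℝ}
    (hIW : ∀ m ∈ I, m ∉ W → ∀ m', |m' - m| ≤ γ → m' ∈ I) {Φ : V → V → ℝ}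
    (hW : ∀ P Q, AverageLinked γ x P → AverageLinked γ x Q → rectAvg x P Q ∈ W →
      0 ≤ rectSum Φ P Q)
    (hΦ : ∀ u v, x u v ∈ I → x u v ∉ W → 0 ≤ Φ u v)
    (hP : AverageLinked γ x P) (hQ : AverageLinked γ x Q) (hI : rectAvg x P Q ∈ I) :
    0 ≤ rectSum Φ P Q := by
  induction hP generalizing Q with
  | @union A B hA hB hd hs ihA ihB =>
    by_cases hm : rectAvg x (A ∪ B) Q ∈ W
    · exact hW _ _ (.union hA hB hd hs) hQ hm
    rw [rectSum_union_left Φ hd]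
    have h₁ := abs_rectAvg_sub_rectAvg_union_le hx hγ hA.card_pos hB.card_pos hQ.card_pos hd hs
    have h₂ := abs_rectAvg_sub_rectAvg_union_le hx hγ hB.card_pos hA.card_pos hQ.card_pos
      hd.symm (by rw [rectSum_comm hx.symm, mul_comm (B.card : ℝ)]; exact hs)
    rw [Finset.union_comm B A] at h₂
    exact add_nonneg (ihA hQ (hIW _ hI hm _ h₁)) (ihB hQ (hIW _ hI hm _ h₂))
  | single u =>
    induction hQ with
    | single v =>
      have hv : rectAvg x {u} {v} = x u v := by simp [rectAvg, rectSum]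
      by_cases hm : rectAvg x {u} {v} ∈ W
      · exact hW _ _ (.single u) (.single v) hm
      · rw [hv] at hI hm
        simpa [rectSum] using hΦ u v hI hm
    | @union A B hA hB hd hs ihA ihB =>
      by_cases hm : rectAvg x {u} (A ∪ B) ∈ W
      · exact hW _ _ (.single u) (.union hA hB hd hs) hm
      rw [rectSum_union_right Φ _ hd]
      have hu : (0 : ℝ) < ({u} : Finset V).card := by simp
      have h₁ := abs_rectAvg_sub_rectAvg_union_le hx hγ hA.card_pos hB.card_pos hu hd hs
      have h₂ := abs_rectAvg_sub_rectAvg_union_le hx hγ hB.card_pos hA.card_pos hu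
        hd.symm (by rw [rectSum_comm hx.symm, mul_comm (B.card : ℝ)]; exact hs)
      rw [Finset.union_comm B A] at h₂
      rw [rectAvg_comm hx A, rectAvg_comm hx (A ∪ B)] at h₁
      rw [rectAvg_comm hx B, rectAvg_comm hx (A ∪ B)] at h₂
      exact add_nonneg (ihA (hIW _ hI hm _ h₁)) (ihB (hIW _ hI hm _ h₂))

/-- The variance of the distance over a rectangle of average-linked sets is at most `γ`. -/
theorem rectAvg_sq_le (hx : UnitPseudometric x) (hγ : 0 ≤ γ)
    (hP : AverageLinked γ x P) (hQ : AverageLinked γ x Q) :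
    rectAvg (fun u v => x u v ^ 2) P Q ≤ rectAvg x P Q ^ 2 + γ := by
  have hp := hP.card_pos
  have hq := hQ.card_pos
  have key : ∑ a ∈ P ×ˢ Q, ∑ b ∈ P ×ˢ Q, (x a.1 a.2 - x b.1 b.2) ^ 2 ≤
      ∑ a ∈ P ×ˢ Q, ∑ b ∈ P ×ˢ Q, (x a.1 b.1 + x a.2 b.2) := by
    refine Finset.sum_le_sum fun a _ => Finset.sum_le_sum fun b _ => ?_
    have h₁ : x a.1 a.2 - x b.1 b.2 ≤ x a.1 b.1 + x a.2 b.2 := by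
      linarith [hx.triangle a.1 a.2 b.1, hx.triangle b.1 a.2 b.2, hx.symm a.2 b.2]
    have h₂ : -(x a.1 a.2 - x b.1 b.2) ≤ x a.1 b.1 + x a.2 b.2 := by
      linarith [hx.triangle b.1 b.2 a.1, hx.triangle a.1 b.2 a.2, hx.symm a.1 b.1]
    have h₃ : |x a.1 a.2 - x b.1 b.2| ≤ 1 := by
      rw [abs_le]
      constructor <;>
        linarith [hx.nonneg a.1 a.2, hx.nonneg b.1 b.2, hx.le_one a.1 a.2, hx.le_one b.1 b.2]
    rw [← sq_abs]
    nlinarith [abs_le'.2 ⟨h₁, h₂⟩, abs_nonneg (x a.1 a.2 - x b.1 b.2)]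
  have lhs : ∑ a ∈ P ×ˢ Q, ∑ b ∈ P ×ˢ Q, (x a.1 a.2 - x b.1 b.2) ^ 2 =
      2 * (P.card * Q.card * rectSum (fun u v => x u v ^ 2) P Q) - 2 * rectSum x P Q ^ 2 := by
    have e₁ : rectSum x P Q = ∑ a ∈ P ×ˢ Q, x a.1 a.2 := by
      rw [Finset.sum_product]; rfl
    have e₂ : rectSum (fun u v => x u v ^ 2) P Q = ∑ a ∈ P ×ˢ Q, x a.1 a.2 ^ 2 := by
      rw [Finset.sum_product]; rfl
    rw [e₁, e₂]
    simp only [sub_sq, Finset.sum_add_distrib, Finset.sum_sub_distrib, Finset.sum_const,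
      nsmul_eq_mul, ← Finset.mul_sum, ← Finset.sum_mul, Finset.card_product]
    push_cast
    ring
  have rhs : ∑ a ∈ P ×ˢ Q, ∑ b ∈ P ×ˢ Q, (x a.1 b.1 + x a.2 b.2) =
      Q.card ^ 2 * rectSum x P P + P.card ^ 2 * rectSum x Q Q := by
    simp only [rectSum, Finset.sum_product, Finset.sum_add_distrib, Finset.sum_const,
      nsmul_eq_mul, ← Finset.mul_sum]
    ring
  rw [lhs, rhs] at key
  have h₁ := mul_le_mul_of_nonneg_left (hP.rectSum_self_le hx hγ) (sq_nonneg (Q.card : ℝ))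
  have h₂ := mul_le_mul_of_nonneg_left (hQ.rectSum_self_le hx hγ) (sq_nonneg (P.card : ℝ))
  unfold rectAvg
  rw [div_pow, div_add' _ _ _ (by positivity), div_le_div_iff₀ (by positivity) (by positivity)]
  generalize (P.card : ℝ) = p at *
  generalize (Q.card : ℝ) = q at *
  have h₃ : p * q * rectSum (fun u v => x u v ^ 2) P Q ≤
      rectSum x P Q ^ 2 + γ * (p * q) ^ 2 := by linarith
  nlinarith [mul_le_mul_of_nonneg_left h₃ (by positivity : 0 ≤ p * q)]

/-- The concave quadratic below the tent function `min z (1 - z)` touching both of its sides. -/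
theorem quadratic_le_tent (z : ℝ) : 4 / 3 * z - 4 / 3 * z ^ 2 - 1 / 48 ≤ min z (1 - z) :=
  le_min (by nlinarith [sq_nonneg (z - 1 / 8)]) (by nlinarith [sq_nonneg (z - 7 / 8)])

theorem rectAvg_tent_ge (hx : UnitPseudometric x) (hγ : 0 ≤ γ)
    (hP : AverageLinked γ x P) (hQ : AverageLinked γ x Q) :
    4 / 3 * rectAvg x P Q - 4 / 3 * (rectAvg x P Q ^ 2 + γ) - 1 / 48 ≤
      rectAvg (fun u v => min (x u v) (1 - x u v)) P Q := by
  have hp := hP.card_pos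
  have hq := hQ.card_pos
  have h : rectSum (fun u v => 4 / 3 * x u v - 4 / 3 * x u v ^ 2 - 1 / 48) P Q ≤
      rectSum (fun u v => min (x u v) (1 - x u v)) P Q :=
    Finset.sum_le_sum fun u _ => Finset.sum_le_sum fun v _ => quadratic_le_tent (x u v)
  have e : rectSum (fun u v => 4 / 3 * x u v - 4 / 3 * x u v ^ 2 - 1 / 48) P Q =
      4 / 3 * rectSum x P Q - 4 / 3 * rectSum (fun u v => x u v ^ 2) P Q -
        1 / 48 * (P.card * Q.card) := by
    simp only [rectSum, Finset.sum_sub_distrib, ← Finset.mul_sum, Finset.sum_const, nsmul_eq_mul]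
    ring
  have h' := div_le_div_of_nonneg_right h (by positivity : 0 ≤ (P.card : ℝ) * Q.card)
  rw [e, sub_div, sub_div, mul_div_assoc, mul_div_assoc, mul_div_assoc,
    div_self (by positivity)] at h'
  have hv := rectAvg_sq_le hx hγ hP hQ
  unfold rectAvg at hv ⊢
  linarith

end Rectangles

section Charging

variable {V : Type*} [DecidableEq V] {x : V → V → ℝ} {P Q : Finset V}

theorem rectSum_eq_mul_rectAvg {V : Type*} {x : V → V → ℝ} {P Q : Finset V}
    (hP : (0 : ℝ) < P.card) (hQ : (0 : ℝ) < Q.card) :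
    rectSum x P Q = P.card * Q.card * rectAvg x P Q := by
  unfold rectAvg
  field_simp

/-- A function dominating `K` times the tent function minus one has nonnegative sum on rectangles
on which the tent function has average at least `1 / K`. -/
theorem rectSum_nonneg_of_tent {V : Type*} {x Φ : V → V → ℝ} {K : ℝ} {P Q : Finset V}
    (hP : (0 : ℝ) < P.card)
    (hQ : (0 : ℝ) < Q.card) (hΦ : ∀ u v, K * min (x u v) (1 - x u v) - 1 ≤ Φ u v)
    (h : 1 ≤ K * rectAvg (fun u v => min (x u v) (1 - x u v)) P Q) : 0 ≤ rectSum Φ P Q := by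
  have h₁ : rectSum (fun u v => K * min (x u v) (1 - x u v) - 1) P Q ≤ rectSum Φ P Q :=
    Finset.sum_le_sum fun u _ => Finset.sum_le_sum fun v _ => hΦ u v
  have h₂ : rectSum (fun u v => K * min (x u v) (1 - x u v) - 1) P Q =
      K * rectSum (fun u v => min (x u v) (1 - x u v)) P Q - P.card * Q.card := by
    simp [rectSum, Finset.sum_sub_distrib, ← Finset.mul_sum]
  rw [h₂, rectSum_eq_mul_rectAvg hP hQ] at h₁
  nlinarith [mul_le_mul_of_nonneg_left h (by positivity : 0 ≤ (P.card : ℝ) * Q.card)]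

/-- Between sets of small average distance, joining all pairs is paid for. -/
theorem rectSum_join_nonneg (hx : UnitPseudometric x)
    (hP : AverageLinked (1 / 10) x P) (hQ : AverageLinked (1 / 10) x Q)
    (h : rectAvg x P Q ≤ 2 / 5) :
    0 ≤ rectSum (fun u v => min (25.7846 * x u v) (25.7846 * (1 - x u v) - 1)) P Q := by
  refine rectSum_nonneg_of_window hx (by norm_num) (I := Set.Iic (2 / 5))
    (W := Set.Icc (3 / 10) (2 / 5)) ?_ ?_ ?_ hP hQ h
  · intro m hm hm' m' h
    simp only [Set.mem_Iic, Set.mem_Icc, not_and_or, not_le, abs_le] at *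
    rcases hm' with hm' | hm' <;> linarith
  · intro P Q hP hQ ⟨h₁, h₂⟩
    refine rectSum_nonneg_of_tent (x := x) (K := 25.7846) hP.card_pos hQ.card_pos ?_ ?_
    · intro u v
      refine le_min ?_ ?_
      · linarith [min_le_left (x u v) (1 - x u v)]
      · linarith [min_le_right (x u v) (1 - x u v)]
    · have := rectAvg_tent_ge hx (by norm_num) hP hQ
      nlinarith
  · intro u v h₁ h₂
    simp only [Set.mem_Iic, Set.mem_Icc, not_and_or, not_le] at *
    exact le_min (by linarith [hx.nonneg u v]) (by linarith)

theorem rectAvg_tent_ge_of_le (hx : UnitPseudometric x)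
    (hP : AverageLinked (1 / 10) x P) (hQ : AverageLinked (1 / 10) x Q)
    (h : rectAvg x P Q ≤ 2 / 5) :
    2 / 5 * rectAvg x P Q ≤ rectAvg (fun u v => min (x u v) (1 - x u v)) P Q := by
  have hp := hP.card_pos
  have hq := hQ.card_pos
  have e (P Q : Finset V) : rectSum (fun u v => min (x u v) (1 - x u v) - 2 / 5 * x u v) P Q =
      rectSum (fun u v => min (x u v) (1 - x u v)) P Q - 2 / 5 * rectSum x P Q := by
    simp [rectSum, Finset.sum_sub_distrib, ← Finset.mul_sum]
  suffices 0 ≤ rectSum (fun u v => min (x u v) (1 - x u v) - 2 / 5 * x u v) P Q by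
    rw [e] at this
    unfold rectAvg
    rw [← mul_div_assoc]
    exact div_le_div_of_nonneg_right (by linarith) (by positivity)
  refine rectSum_nonneg_of_window hx (by norm_num) (I := Set.Iic (2 / 5))
    (W := Set.Icc (3 / 10) (2 / 5)) ?_ ?_ ?_ hP hQ h
  · intro m hm hm' m' h
    simp only [Set.mem_Iic, Set.mem_Icc, not_and_or, not_le, abs_le] at *
    rcases hm' with hm' | hm' <;> linarith
  · intro P Q hP hQ ⟨h₁, h₂⟩
    rw [e, rectSum_eq_mul_rectAvg hP.card_pos hQ.card_pos,
      rectSum_eq_mul_rectAvg (x := x) hP.card_pos hQ.card_pos]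
    have h₃ := rectAvg_tent_ge hx (by norm_num) hP hQ
    have h₄ : 2 / 5 * rectAvg x P Q ≤ rectAvg (fun u v => min (x u v) (1 - x u v)) P Q := by
      nlinarith
    have := mul_le_mul_of_nonneg_left h₄ (mul_pos hP.card_pos hQ.card_pos).le
    linarith
  · intro u v h₁ h₂
    simp only [Set.mem_Iic, Set.mem_Icc, not_and_or, not_le] at *
    have := hx.nonneg u v
    rw [min_eq_left (by linarith)]
    linarith

/-- Between sets whose average distance exceeds the threshold, separating all pairs is paid
for. -/
theorem rectSum_cut_nonneg (hx : UnitPseudometric x)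
    (hP : AverageLinked (1 / 10) x P) (hQ : AverageLinked (1 / 10) x Q)
    (h : 1 / 10 ≤ rectAvg x P Q) :
    0 ≤ rectSum (fun u v => min (25.7846 * x u v - 1) (25.7846 * (1 - x u v))) P Q := by
  have hΦ (u v : V) : 25.7846 * min (x u v) (1 - x u v) - 1 ≤
      min (25.7846 * x u v - 1) (25.7846 * (1 - x u v)) :=
    le_min (by linarith [min_le_left (x u v) (1 - x u v)])
      (by linarith [min_le_right (x u v) (1 - x u v)])
  rcases le_or_gt (rectAvg x P Q) (2 / 5) with h' | h'
  · refine rectSum_nonneg_of_tent (x := x) (K := 25.7846) hP.card_pos hQ.card_pos hΦ ?_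
    linarith [rectAvg_tent_ge_of_le hx hP hQ h']
  refine rectSum_nonneg_of_window hx (by norm_num) (I := Set.Ici (3 / 10))
    (W := Set.Icc (3 / 10) (2 / 5)) ?_ ?_ ?_ hP hQ (by simp only [Set.mem_Ici]; linarith)
  · intro m hm hm' m' h
    simp only [Set.mem_Ici, Set.mem_Icc, not_and_or, not_le, abs_le] at *
    rcases hm' with hm' | hm' <;> linarith
  · intro P Q hP hQ ⟨h₁, h₂⟩
    refine rectSum_nonneg_of_tent (x := x) (K := 25.7846) hP.card_pos hQ.card_pos hΦ ?_
    have := rectAvg_tent_ge hx (by norm_num) hP hQ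
    nlinarith
  · intro u v h₁ h₂
    simp only [Set.mem_Ici, Set.mem_Icc, not_and_or, not_le] at *
    exact le_min (by linarith) (by linarith [hx.le_one u v])

/-- Inside an average-linked set, joining all pairs is paid for. -/
theorem rectSum_self_join_nonneg (hx : UnitPseudometric x) (hP : AverageLinked (1 / 10) x P) :
    0 ≤ rectSum (fun u v => min (25.7846 * x u v) (25.7846 * (1 - x u v) - 1)) P P := by
  induction hP with
  | single v =>
    simp only [rectSum, Finset.sum_singleton, hx.self]
    norm_num
  | @union P Q hP hQ hd hs ih₁ ih₂ =>
    have hp := hP.card_pos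
    have hq := hQ.card_pos
    have h : rectAvg x P Q ≤ 2 / 5 := by
      unfold rectAvg
      rw [div_le_iff₀ (by positivity)]
      nlinarith [mul_pos hp hq]
    have h₁ := rectSum_join_nonneg hx hP hQ h
    have h₂ := rectSum_join_nonneg hx hQ hP (rectAvg_comm hx P Q ▸ h)
    rw [rectSum_union_left _ hd, rectSum_union_right _ _ hd, rectSum_union_right _ _ hd]
    linarith

end Charging

section Linkage

variable {V : Type*} [Fintype V] [DecidableEq V]

/-- The cluster with label `a` of the clustering given by the labelling `f`. -/
def cluster (f : V → V) (a : V) : Finset V := Finset.univ.filter fun v => f v = a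

/-- Average linkage run to completion from a given clustering. -/
theorem exists_linkage (γ : ℝ) (x : V → V → ℝ) (f : V → V)
    (hf : ∀ u, AverageLinked γ x (cluster f (f u))) :
    ∃ g : V → V, (∀ u v, f u = f v → g u = g v) ∧
      (∀ u, AverageLinked γ x (cluster g (g u))) ∧
      ∀ u v, g u ≠ g v → γ * ((cluster g (g u)).card * (cluster g (g v)).card) <
        rectSum x (cluster g (g u)) (cluster g (g v)) := by
  induction hn : (Finset.univ.image f).card using Nat.strong_induction_on generalizing f with
  | _ n ih =>
    by_cases hsep : ∀ u v, f u ≠ f v → γ * ((cluster f (f u)).card * (cluster f (f v)).card) <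
        rectSum x (cluster f (f u)) (cluster f (f v))
    · exact ⟨f, fun _ _ h => h, hf, hsep⟩
    push Not at hsep
    obtain ⟨a, b, hab, hs⟩ := hsep
    set f' : V → V := fun v => if f v = f b then f a else f v with hf'
    have hmerge : cluster f' (f a) = cluster f (f a) ∪ cluster f (f b) := by
      ext v
      simp only [cluster, hf', Finset.mem_filter, Finset.mem_union, Finset.mem_univ, true_and]
      split_ifs with h <;> simp [h]
    have hkeep (c : V) (hca : c ≠ f a) (hcb : c ≠ f b) : cluster f' c = cluster f c := by
      ext v
      simp only [cluster, hf', Finset.mem_filter, Finset.mem_univ, true_and]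
      split_ifs with h
      · simp [h, hca.symm, hcb.symm]
      · rfl
    have hdisj : Disjoint (cluster f (f a)) (cluster f (f b)) := by
      rw [Finset.disjoint_left]
      simp only [cluster, Finset.mem_filter, Finset.mem_univ, true_and]
      exact fun v h₁ h₂ => hab (h₁.symm.trans h₂)
    have hlinked (u : V) : AverageLinked γ x (cluster f' (f' u)) := by
      by_cases hu : f' u = f a
      · rw [hu, hmerge]
        exact .union (hf a) (hf b) hdisj hs
      · have hub : f u ≠ f b := fun h => hu (by simp [hf', h])
        have hfu : f' u = f u := by simp [hf', hub]
        rw [hfu] at hu ⊢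
        rw [hkeep _ hu hub]
        exact hf u
    have hcard : (Finset.univ.image f').card < n := by
      rw [← hn]
      refine Finset.card_lt_card ((Finset.ssubset_iff_of_subset ?_).2 ⟨f b, by simp, ?_⟩)
      · intro c hc
        obtain ⟨v, -, rfl⟩ := Finset.mem_image.1 hc
        simp only [hf']
        split_ifs <;> simp
      · simp only [Finset.mem_image, Finset.mem_univ, true_and, not_exists, hf']
        intro v
        split_ifs with h
        · exact hab
        · exact h
    obtain ⟨g, hg₁, hg₂, hg₃⟩ := ih _ hcard f' hlinked rfl
    exact ⟨g, fun u v h => hg₁ u v (by simp [hf', h]), hg₂, hg₃⟩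

/-- Average linkage run bottom-up along a decreasing sequence of functions. -/
theorem exists_linkage_hierarchy (γ : ℝ) (x : ℕ → V → V → ℝ)
    (hx : ∀ t u v, x (t + 1) u v ≤ x t u v) :
    ∃ f : ℕ → V → V, (∀ t u v, f t u = f t v → f (t + 1) u = f (t + 1) v) ∧
      (∀ t u, AverageLinked γ (x t) (cluster (f t) (f t u))) ∧
      ∀ t u v, f t u ≠ f t v →
        γ * ((cluster (f t) (f t u)).card * (cluster (f t) (f t v)).card) <
          rectSum (x t) (cluster (f t) (f t u)) (cluster (f t) (f t v)) := by
  choose! step h₁ h₂ h₃ using fun t => exists_linkage (V := V) γ (x t)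
  have hid (u : V) : AverageLinked γ (x 0) (cluster id (id u)) := by
    have : cluster id u = {u} := by ext v; simp [cluster]
    simpa [this] using AverageLinked.single u
  let f : ℕ → V → V := fun t => Nat.rec (step 0 id) (fun t g => step (t + 1) g) t
  have hlinked (t : ℕ) : ∀ u, AverageLinked γ (x t) (cluster (f t) (f t u)) := by
    induction t with
    | zero => exact h₂ 0 id hid
    | succ t ih => exact h₂ (t + 1) (f t) fun u => (ih u).mono (hx t)
  refine ⟨f, fun t => ?_, hlinked, fun t => ?_⟩
  · exact h₁ (t + 1) (f t) fun u => (hlinked t u).mono (hx t)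
  · cases t with
    | zero => exact h₃ 0 id hid
    | succ t => exact h₃ (t + 1) (f t) fun u => (hlinked t u).mono (hx t)

/-- The total charge of a separated average-linkage clustering is nonnegative. -/
theorem sum_charge_nonneg {x : V → V → ℝ} (hx : UnitPseudometric x) {f : V → V}
    (hf : ∀ u, AverageLinked (1 / 10) x (cluster f (f u)))
    (hsep : ∀ u v, f u ≠ f v → 1 / 10 * ((cluster f (f u)).card * (cluster f (f v)).card : ℝ) <
        rectSum x (cluster f (f u)) (cluster f (f v))) :
    0 ≤ ∑ u, ∑ v, if f u = f v then min (25.7846 * x u v) (25.7846 * (1 - x u v) - 1)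
      else min (25.7846 * x u v - 1) (25.7846 * (1 - x u v)) := by
  set Φ : V → V → ℝ := fun u v =>
    if f u = f v then min (25.7846 * x u v) (25.7846 * (1 - x u v) - 1)
      else min (25.7846 * x u v - 1) (25.7846 * (1 - x u v)) with hΦ
  have h : ∑ u, ∑ v, Φ u v = ∑ a ∈ Finset.univ.image f, ∑ b ∈ Finset.univ.image f,
      rectSum Φ (cluster f a) (cluster f b) := by
    rw [← Finset.sum_fiberwise_of_maps_to (g := f) (t := Finset.univ.image f)
      (fun u _ => Finset.mem_image_of_mem f (Finset.mem_univ u))]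
    refine Finset.sum_congr rfl fun a _ => ?_
    unfold rectSum
    rw [Finset.sum_comm (s := Finset.univ.image f)]
    refine Finset.sum_congr rfl fun u _ => ?_
    rw [← Finset.sum_fiberwise_of_maps_to (g := f) (t := Finset.univ.image f)
      (fun u _ => Finset.mem_image_of_mem f (Finset.mem_univ u))]
    rfl
  rw [h]
  refine Finset.sum_nonneg fun a ha => Finset.sum_nonneg fun b hb => ?_
  obtain ⟨u, -, rfl⟩ := Finset.mem_image.1 ha
  obtain ⟨v, -, rfl⟩ := Finset.mem_image.1 hb
  by_cases huv : f u = f v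
  · rw [← huv]
    refine (rectSum_self_join_nonneg hx (hf u)).trans_eq
      (Finset.sum_congr rfl fun p hp => Finset.sum_congr rfl fun q hq => ?_)
    simp only [cluster, Finset.mem_filter] at hp hq
    simp [hΦ, hp.2, hq.2]
  · have hpos := mul_pos (hf u).card_pos (hf v).card_pos
    have havg : 1 / 10 ≤ rectAvg x (cluster f (f u)) (cluster f (f v)) := by
      unfold rectAvg
      rw [le_div_iff₀ hpos]
      exact (hsep u v huv).le
    refine (rectSum_cut_nonneg hx (hf u) (hf v) havg).trans_eq
      (Finset.sum_congr rfl fun p hp => Finset.sum_congr rfl fun q hq => ?_)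
    simp only [cluster, Finset.mem_filter] at hp hq
    simp [hΦ, hp.2, hq.2, huv]

end Linkage

section Objective

variable {V : Type*} [Fintype V] [DecidableEq V]

theorem pairTogether_mk {V : Type*} {R : V → V → Prop} (hR : ∀ u v, R u v → R v u) (u v : V) :
    PairTogether R s(u, v) ↔ R u v := by
  constructor
  · rintro ⟨a, b, hab, h⟩
    rcases Sym2.eq_iff.1 hab with ⟨rfl, rfl⟩ | ⟨rfl, rfl⟩
    exacts [h, hR _ _ h]
  · exact fun h => ⟨u, v, rfl, h⟩

/-- Every non-diagonal unordered pair arises from exactly two ordered pairs. -/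
theorem sum_sum_sym2 (h : Sym2 V → ℝ) :
    ∑ u, ∑ v, (if u = v then 0 else h s(u, v)) =
      2 * ∑ e ∈ Finset.univ.filter (fun e : Sym2 V => ¬ e.IsDiag), h e := by
  have h₁ : ∑ u, ∑ v, (if u = v then 0 else h s(u, v)) =
      ∑ p ∈ Finset.univ.filter (fun p : V × V => p.1 ≠ p.2), h s(p.1, p.2) := by
    rw [Finset.sum_filter, ← Finset.univ_product_univ, Finset.sum_product]
    simp only [ne_eq, ite_not]
  rw [h₁, ← Finset.sum_fiberwise_of_maps_to (g := fun p : V × V => s(p.1, p.2))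
    (t := Finset.univ.filter (fun e : Sym2 V => ¬ e.IsDiag))
    (fun p hp => by simpa using hp), Finset.mul_sum]
  refine Finset.sum_congr rfl fun e he => ?_
  induction e using Sym2.ind with
  | _ a b =>
    have hab : a ≠ b := by simpa using he
    have hfib : ((Finset.univ.filter (fun p : V × V => p.1 ≠ p.2)).filter
        fun p => s(p.1, p.2) = s(a, b)) = {(a, b), (b, a)} := by
      ext ⟨p, q⟩
      simp only [Finset.mem_filter, Finset.mem_univ, true_and, Sym2.eq_iff,
        Finset.mem_insert, Finset.mem_singleton, Prod.mk.injEq]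
      constructor
      · exact fun h => h.2
      · rintro (⟨rfl, rfl⟩ | ⟨rfl, rfl⟩)
        exacts [⟨hab, .inl ⟨rfl, rfl⟩⟩, ⟨hab.symm, .inr ⟨rfl, rfl⟩⟩]
    rw [hfib, Finset.sum_pair (by simp [hab]), Sym2.eq_swap (a := b)]
    ring

/-- The cost of one layer as a sum over all pairs. -/
theorem layerCost_eq_sum {E : Finset (Sym2 V)} (hE : ∀ e ∈ E, ¬ e.IsDiag) (R : V → V → Prop) :
    (({e : Sym2 V | ¬ e.IsDiag ∧ e ∉ E ∧ PairTogether R e}).ncard : ℝ) +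
        (({e : Sym2 V | e ∈ E ∧ ¬ PairTogether R e}).ncard : ℝ) =
      ∑ e ∈ Finset.univ.filter (fun e : Sym2 V => ¬ e.IsDiag),
        if e ∈ E then (if PairTogether R e then 0 else 1)
          else if PairTogether R e then 1 else 0 := by
  have h (p : Sym2 V → Prop) (hp : ∀ e, p e → ¬ e.IsDiag) :
      (({e : Sym2 V | p e}).ncard : ℝ) =
        ∑ e ∈ Finset.univ.filter (fun e : Sym2 V => ¬ e.IsDiag), if p e then 1 else 0 := by
    rw [Set.ncard_eq_toFinset_card', Finset.sum_boole, Finset.filter_filter]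
    congr 2
    ext e
    simpa using hp e
  rw [h _ fun e he => he.1, h _ fun e he => hE e he.1, ← Finset.sum_add_distrib]
  refine Finset.sum_congr rfl fun e he => ?_
  have he' : ¬ e.IsDiag := (Finset.mem_filter.1 he).2
  by_cases h₁ : e ∈ E <;> by_cases h₂ : PairTogether R e <;> simp [h₁, h₂, he']

/-- The fractional cost of one layer as a sum over all pairs. -/
theorem layerVal_eq_sum {E : Finset (Sym2 V)} (hE : ∀ e ∈ E, ¬ e.IsDiag) (y : Sym2 V → ℝ) :
    (∑ e ∈ E, y e) + ∑ e ∈ Finset.univ.filter (fun e : Sym2 V => ¬ e.IsDiag) \ E, (1 - y e) =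
      ∑ e ∈ Finset.univ.filter (fun e : Sym2 V => ¬ e.IsDiag),
        if e ∈ E then y e else 1 - y e := by
  have hsub : E ⊆ Finset.univ.filter (fun e : Sym2 V => ¬ e.IsDiag) := fun e he => by
    simpa using hE e he
  rw [← Finset.sum_sdiff hsub, add_comm]
  congr 1
  · exact Finset.sum_congr rfl fun e he => by simp [(Finset.mem_sdiff.1 he).2]
  · exact Finset.sum_congr rfl fun e he => by simp [he]

/-- Average linkage loses at most the factor `25.7846` on a single layer. -/
theorem layerCost_le {E : Finset (Sym2 V)} (hE : ∀ e ∈ E, ¬ e.IsDiag) {y : Sym2 V → ℝ}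
    (hy : UnitPseudometric fun u v => y s(u, v)) {f : V → V}
    (hf : ∀ u, AverageLinked (1 / 10) (fun u v => y s(u, v)) (cluster f (f u)))
    (hsep : ∀ u v, f u ≠ f v → 1 / 10 * ((cluster f (f u)).card * (cluster f (f v)).card : ℝ) <
        rectSum (fun u v => y s(u, v)) (cluster f (f u)) (cluster f (f v))) :
    (({e : Sym2 V | ¬ e.IsDiag ∧ e ∉ E ∧ PairTogether (fun u v => f u = f v) e}).ncard : ℝ) +
        (({e : Sym2 V | e ∈ E ∧ ¬ PairTogether (fun u v => f u = f v) e}).ncard : ℝ) ≤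
      25.7846 * ((∑ e ∈ E, y e) +
        ∑ e ∈ Finset.univ.filter (fun e : Sym2 V => ¬ e.IsDiag) \ E, (1 - y e)) := by
  rw [layerCost_eq_sum hE, layerVal_eq_sum hE, Finset.mul_sum, ← sub_nonneg,
    ← Finset.sum_sub_distrib]
  refine nonneg_of_mul_nonneg_right ?_ (two_pos (α := ℝ))
  rw [← sum_sum_sym2]
  refine (sum_charge_nonneg hy hf hsep).trans
    (Finset.sum_le_sum fun u _ => Finset.sum_le_sum fun v _ => ?_)
  by_cases huv : u = v
  · subst huv
    simp only [if_true, hy.self]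
    norm_num
  have hnn := hy.nonneg u v
  have hle := hy.le_one u v
  simp only [if_neg huv, pairTogether_mk (R := fun u v => f u = f v) (fun _ _ h => h.symm)]
  split_ifs
  · exact (min_le_left _ _).trans_eq (sub_zero _).symm
  · exact min_le_right _ _
  · exact min_le_left _ _
  · exact (min_le_right _ _).trans_eq (sub_zero _).symm

/-- Consistent collections of partitions, given as equivalence relations. -/
def Consistent {V : Type*} (ℓ : ℕ) (R : ℕ → V → V → Prop) : Prop :=
  (∀ t ∈ Finset.Icc 1 ℓ, Equivalence (R t)) ∧
    ∀ t, 1 ≤ t → t < ℓ → ∀ u v, R t u v → R (t + 1) u v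

/-- Every feasible fractional solution can be rounded with loss at most `25.7846`. -/
theorem exists_rounding {ℓ : ℕ} (hℓ : 1 ≤ ℓ) {δ : ℕ → ℝ} (hδ : ∀ t, 0 ≤ δ t)
    {E : ℕ → Finset (Sym2 V)} (hE : ∀ t, ∀ e ∈ E t, ¬ e.IsDiag) {x : ℕ → Sym2 V → ℝ}
    (hx : LPStarFeasible ℓ x) :
    ∃ R : ℕ → V → V → Prop, Consistent ℓ R ∧
      ClusCost ℓ δ E R ≤ 25.7846 * LPStarVal ℓ δ E x := by
  obtain ⟨hself, htri, hbd, hmono⟩ := hx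
  set c : ℕ → ℕ := fun t => max 1 (min t ℓ) with hc
  have hcmem (t : ℕ) : c t ∈ Finset.Icc 1 ℓ := by
    simp only [hc, Finset.mem_Icc]
    omega
  have hcstep (t : ℕ) : c (t + 1) = c t ∨ c (t + 1) = c t + 1 ∧ 1 ≤ c t ∧ c t < ℓ := by
    simp only [hc]
    omega
  obtain ⟨f, hf₁, hf₂, hf₃⟩ := exists_linkage_hierarchy (1 / 10)
    (fun t (u v : V) => x (c t) s(u, v)) fun t u v => by
      rcases hcstep t with h | ⟨h, h₁, h₂⟩
      · rw [h]
      · rw [h]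
        exact hmono _ h₁ h₂ _
  refine ⟨fun t u v => f t u = f t v, ⟨fun t _ => ⟨fun _ => rfl, fun h => h.symm,
    fun h₁ h₂ => h₁.trans h₂⟩, fun t _ _ u v h => hf₁ t u v h⟩, ?_⟩
  unfold ClusCost LPStarVal
  rw [Finset.mul_sum]
  refine Finset.sum_le_sum fun t ht => ?_
  have hct : c t = t := by
    simp only [hc]
    rw [Finset.mem_Icc] at ht
    omega
  have hmetric : UnitPseudometric fun u v => x t s(u, v) :=
    ⟨hself t ht, fun u v => by rw [Sym2.eq_swap], htri t ht, fun u v => (hbd t ht _).1,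
      fun u v => (hbd t ht _).2⟩
  have h₂ := hf₂ t
  have h₃ := hf₃ t
  simp only [hct] at h₂ h₃
  have := mul_le_mul_of_nonneg_left (layerCost_le (hE t) hmetric h₂ h₃) (hδ t)
  rw [mul_left_comm]
  convert this using 8

/-- Some consistent collection of partitions has minimum cost. -/
theorem exists_optimal_clustering {V : Type*} [Fintype V] (ℓ : ℕ) (δ : ℕ → ℝ)
    (E : ℕ → Finset (Sym2 V)) :
    ∃ R : ℕ → V → V → Prop, Consistent ℓ R ∧
      ∀ S, Consistent ℓ S → ClusCost ℓ δ E R ≤ ClusCost ℓ δ E S := by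
  let extend : (Fin (ℓ + 1) → V → V → Prop) → ℕ → V → V → Prop :=
    fun g t => g (Fin.ofNat (ℓ + 1) t)
  let restrict : (ℕ → V → V → Prop) → Fin (ℓ + 1) → V → V → Prop := fun R t => R t
  have hext (R : ℕ → V → V → Prop) (t : ℕ) (ht : t ≤ ℓ) : extend (restrict R) t = R t := by
    simp only [extend, restrict, Fin.ofNat]
    rw [Nat.mod_eq_of_lt (by omega)]
  have hcons (R : ℕ → V → V → Prop) (hR : Consistent ℓ R) :
      Consistent ℓ (extend (restrict R)) := by
    refine ⟨fun t ht => ?_, fun t h₁ h₂ => ?_⟩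
    · rw [hext R t (Finset.mem_Icc.1 ht).2]
      exact hR.1 t ht
    · rw [hext R t h₂.le, hext R (t + 1) h₂]
      exact hR.2 t h₁ h₂
  have hcost (R : ℕ → V → V → Prop) :
      ClusCost ℓ δ E (extend (restrict R)) = ClusCost ℓ δ E R :=
    Finset.sum_congr rfl fun t ht => by rw [hext R t (Finset.mem_Icc.1 ht).2]
  have heq : Consistent ℓ fun _ : ℕ => (Eq : V → V → Prop) :=
    ⟨fun _ _ => eq_equivalence, fun _ _ _ _ _ h => h⟩
  obtain ⟨g, hg, hmin⟩ := Set.exists_min_image {g | Consistent ℓ (extend g)}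
    (fun g => ClusCost ℓ δ E (extend g)) (Set.toFinite _) ⟨restrict fun _ => Eq, hcons _ heq⟩
  exact ⟨extend g, hg, fun S hS => (hmin _ (hcons S hS)).trans_eq (hcost S)⟩

end Objective

/-- For every instance of hierarchical correlation clustering there is a consistent
collection of partitions (encoded as equivalence relations `R t`, layer `t`
refining layer `t+1`) whose weighted number of disagreements is at most
`25.7846` times the objective value of every feasible LP-(*) solution (hence at
most `25.7846` times the LP minimum); in particular it is at most `25.7846`
times the weighted number of disagreements of every consistent hierarchical
clustering. -/
theorem stmt0 (V : Type*) [Fintype V] [DecidableEq V]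
    (ℓ : ℕ) (hℓ : 1 ≤ ℓ)
    (δ : ℕ → ℝ) (hδ : ∀ t, 0 ≤ δ t)
    (E : ℕ → Finset (Sym2 V)) (hE : ∀ t, ∀ e ∈ E t, ¬ e.IsDiag) :
    ∃ R : ℕ → V → V → Prop,
      (∀ t ∈ Finset.Icc 1 ℓ, Equivalence (R t)) ∧
      (∀ t, 1 ≤ t → t < ℓ → ∀ u v, R t u v → R (t + 1) u v) ∧
      (∀ x : ℕ → Sym2 V → ℝ, LPStarFeasible ℓ x →
        ClusCost ℓ δ E R ≤ 25.7846 * LPStarVal ℓ δ E x) ∧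
      (∀ S : ℕ → V → V → Prop,
        (∀ t ∈ Finset.Icc 1 ℓ, Equivalence (S t)) →
        (∀ t, 1 ≤ t → t < ℓ → ∀ u v, S t u v → S (t + 1) u v) →
        ClusCost ℓ δ E R ≤ 25.7846 * ClusCost ℓ δ E S) := by
  obtain ⟨R, hR, hmin⟩ := exists_optimal_clustering ℓ δ E
  refine ⟨R, hR.1, hR.2, fun x hx => ?_, fun S hS₁ hS₂ => ?_⟩
  · obtain ⟨S, hS, hle⟩ := exists_rounding hℓ hδ hE hx
    exact (hmin S hS).trans hle
  · have hnonneg : 0 ≤ ClusCost ℓ δ E S :=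
      Finset.sum_nonneg fun t _ => mul_nonneg (hδ t) (by positivity)
    have hle := hmin S ⟨hS₁, hS₂⟩
    linarith
end

section
/- For every finite set V, every ℓ ≥ 1, and every assignment of a layer t_{u,v} ∈ {1,…,ℓ} to each unordered pair of distinct elements of V, there exists a consistent collection of partitions P^(1),…,P^(ℓ) of V (each P^(t) refines P^(t+1)) such that the number of pairs {u,v} whose top-most separation layer t*_{u,v} (the largest t with u and v in different parts of P^(t), and 0 if u,v are in the same part of every P^(t)) differs from t_{u,v} is at most 5 times the minimum objective value of LP-(L0) over all feasible fractional solutions. -/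
open Finset
open scoped Classical

/-- Feasibility for LP-(L0): each layer `t ∈ {1,…,ℓ}` carries a `[0,1]`-valued
function on unordered pairs (vanishing on the diagonal) satisfying the
triangle inequality, the values are monotone non-increasing bottom-up, and the
convention `x^(ℓ+1) := 0` holds. -/
def LPL0Feasible {V : Type*} (ℓ : ℕ) (x : ℕ → Sym2 V → ℝ) : Prop :=
  (∀ t ∈ Finset.Icc 1 ℓ, ∀ u : V, x t s(u, u) = 0) ∧
  (∀ t ∈ Finset.Icc 1 ℓ, ∀ u v p : V, x t s(u, v) ≤ x t s(u, p) + x t s(p, v)) ∧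
  (∀ t ∈ Finset.Icc 1 ℓ, ∀ e : Sym2 V, 0 ≤ x t e ∧ x t e ≤ 1) ∧
  (∀ t, 1 ≤ t → t < ℓ → ∀ e : Sym2 V, x (t + 1) e ≤ x t e) ∧
  (∀ e : Sym2 V, x (ℓ + 1) e = 0)

/-- The objective value of LP-(L0):
`Σ_{{u,v}, u≠v} ((1 − x^(t_{u,v}){u,v}) + x^(t_{u,v}+1){u,v})`. -/
noncomputable def LPL0Val {V : Type*} [Fintype V] [DecidableEq V]
    (tlay : Sym2 V → ℕ) (x : ℕ → Sym2 V → ℝ) : ℝ :=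
  ∑ e ∈ Finset.univ.filter (fun e : Sym2 V => ¬ e.IsDiag),
    ((1 - x (tlay e) e) + x (tlay e + 1) e)

/-- The two kinds of lower bound, in terms of the distance `d` of a pair, on the amount `a` that
the pair leaves over when it is separated. -/
def SurplusBound (d a : ℝ) : Prop :=
  5 * d - 1 ≤ a ∨ (0 ≤ a ∧ 4 - 5 * d ≤ a)

lemma SurplusBound.nonneg_of_le {d a : ℝ} (h : SurplusBound d a) (hd : 2 / 5 ≤ d) : 0 ≤ a := by
  rcases h with h | h
  · linarith
  · exact h.1

lemma SurplusBound.le_of_le {d a : ℝ} (h : SurplusBound d a) (hd : d ≤ 2 / 5) :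
    5 * d - 1 ≤ a := by
  rcases h with h | h <;> linarith

/-- If the points of `B` have average distance at most `1/5` and maximal distance at most `2/5`
from a centre at distance more than `2/5` from `w`, then separating `w` from all of `B` leaves a
nonnegative total surplus. -/
lemma sum_surplus_nonneg_of_average_le {V : Type*} (B : Finset V) (dist dw pay : V → ℝ) (D : ℝ)
    (hD : 2 / 5 < D) (h0 : ∀ v ∈ B, 0 ≤ dist v) (hr : ∀ v ∈ B, dist v ≤ 2 / 5)
    (havg : ∑ v ∈ B, (5 * dist v - 1) ≤ 0)
    (hlo : ∀ v ∈ B, D - dist v ≤ dw v) (hhi : ∀ v ∈ B, dw v ≤ D + dist v)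
    (hpay : ∀ v ∈ B, SurplusBound (dw v) (pay v)) :
    0 ≤ ∑ v ∈ B, pay v := by
  rcases le_total (3 / 5) D with hD' | hD'
  · refine Finset.sum_nonneg fun v hv => ?_
    rcases hpay v hv with h | h
    · linarith [hr v hv, hlo v hv]
    · exact h.1
  · have key : ∀ v ∈ B, (3 - 5 * D) * -(5 * dist v - 1) ≤ pay v := by
      intro v hv
      have hx0 := h0 v hv
      have hx := hr v hv
      rcases hpay v hv with h | ⟨h, h'⟩
      · nlinarith [hlo v hv, mul_nonneg (sub_nonneg.2 hD.le) (sub_nonneg.2 hx)]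
      · rcases le_total (1 / 5) (dist v) with hx' | hx'
        · nlinarith [mul_nonneg (sub_nonneg.2 hD') (sub_nonneg.2 hx')]
        · nlinarith [hhi v hv, mul_nonneg hx0 (sub_nonneg.2 hD')]
    refine le_trans ?_ (Finset.sum_le_sum key)
    rw [← Finset.mul_sum, Finset.sum_neg_distrib]
    exact mul_nonneg (by linarith) (by linarith)

/-- One cluster around `p` can be carved out of `S` inside the `Q`-class of `p`, with diameter at
most `4/5` and nonnegative total surplus of the separated pairs. -/
lemma exists_cluster {V : Type*} [DecidableEq V] (Q : V → V → Prop) (hQ : Equivalence Q)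
    (d pay : V → V → ℝ) (d_self : ∀ u, d u u = 0) (d_symm : ∀ u v, d u v = d v u)
    (d_tri : ∀ u v p, d u v ≤ d u p + d p v) (d_nonneg : ∀ u v, 0 ≤ d u v)
    (hpay : ∀ u v, u ≠ v → Q u v → SurplusBound (d u v) (pay u v))
    (S : Finset V) (p : V) (hp : p ∈ S) :
    ∃ B ⊆ S, p ∈ B ∧ (∀ u ∈ B, ∀ v ∈ B, Q u v ∧ d u v ≤ 4 / 5) ∧
      0 ≤ ∑ v ∈ B, ∑ w ∈ S \ B, if Q v w then pay v w else 0 := by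
  set B := S.filter (fun u => Q p u ∧ d p u ≤ 2 / 5) with hB
  have hpB : p ∈ B := by
    simp only [hB, Finset.mem_filter, d_self]
    exact ⟨hp, hQ.refl p, by norm_num⟩
  by_cases havg : ∑ v ∈ B, (5 * d p v - 1) ≤ 0
  · refine ⟨B, Finset.filter_subset _ _, hpB, ?_, ?_⟩
    · intro u hu v hv
      simp only [hB, Finset.mem_filter] at hu hv
      exact ⟨hQ.trans (hQ.symm hu.2.1) hv.2.1,
        by linarith [d_tri u v p, d_symm u p, hu.2.2, hv.2.2]⟩
    · rw [Finset.sum_comm]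
      refine Finset.sum_nonneg fun w hw => ?_
      obtain ⟨hwS, hwB⟩ := Finset.mem_sdiff.1 hw
      by_cases hpw : Q p w
      · have hD : 2 / 5 < d p w := by
          by_contra hcon
          exact hwB (Finset.mem_filter.2 ⟨hwS, hpw, not_lt.1 hcon⟩)
        have hQB : ∀ v ∈ B, Q v w := fun v hv =>
          hQ.trans (hQ.symm (Finset.mem_filter.1 hv).2.1) hpw
        rw [Finset.sum_congr rfl fun v hv => if_pos (hQB v hv)]
        refine sum_surplus_nonneg_of_average_le B (d p) (fun v => d v w) _ (d p w) hD
          (fun v _ => d_nonneg p v) (fun v hv => (Finset.mem_filter.1 hv).2.2) havg ?_ ?_ ?_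
        · intro v _
          linarith [d_tri p w v]
        · intro v _
          linarith [d_tri v w p, d_symm v p]
        · intro v hv
          exact hpay v w (fun h => hwB (h ▸ hv)) (hQB v hv)
      · refine (Finset.sum_eq_zero fun v hv => if_neg fun h => hpw ?_).ge
        exact hQ.trans (Finset.mem_filter.1 hv).2.1 h
  · refine ⟨{p}, Finset.singleton_subset_iff.2 hp, Finset.mem_singleton_self p, ?_, ?_⟩
    · intro u hu v hv
      rw [Finset.mem_singleton] at hu hv
      subst hu hv
      exact ⟨hQ.refl _, by rw [d_self]; norm_num⟩
    · rw [Finset.sum_singleton]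
      have hsub : B \ {p} ⊆ S \ {p} :=
        Finset.sdiff_subset_sdiff (Finset.filter_subset _ _) subset_rfl
      have hsplit := Finset.sum_sdiff (f := fun v => 5 * d p v - 1)
        (Finset.singleton_subset_iff.2 hpB)
      rw [Finset.sum_singleton, d_self] at hsplit
      have hin : ∑ v ∈ B \ {p}, (5 * d p v - 1) ≤
          ∑ w ∈ B \ {p}, if Q p w then pay p w else 0 := by
        refine Finset.sum_le_sum fun w hw => ?_
        obtain ⟨hwB, hwp⟩ := Finset.mem_sdiff.1 hw
        obtain ⟨-, hpw, hdw⟩ := Finset.mem_filter.1 hwB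
        rw [if_pos hpw]
        exact (hpay p w (fun h => hwp (by simp [h])) hpw).le_of_le hdw
      have hout : ∑ w ∈ B \ {p}, (if Q p w then pay p w else 0) ≤
          ∑ w ∈ S \ {p}, if Q p w then pay p w else 0 := by
        refine Finset.sum_le_sum_of_subset_of_nonneg hsub fun w hw hwB => ?_
        obtain ⟨hwS, hwp⟩ := Finset.mem_sdiff.1 hw
        split_ifs with hpw
        · refine (hpay p w (fun h => hwp (by simp [h])) hpw).nonneg_of_le ?_
          by_contra hcon
          exact hwB (Finset.mem_sdiff.2
            ⟨Finset.mem_filter.2 ⟨hwS, hpw, (not_le.1 hcon).le⟩, hwp⟩)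
        · exact le_rfl
      linarith

lemma exists_clustering_on {V : Type*} [DecidableEq V] (Q : V → V → Prop) (hQ : Equivalence Q)
    (d pay : V → V → ℝ) (d_self : ∀ u, d u u = 0) (d_symm : ∀ u v, d u v = d v u)
    (d_tri : ∀ u v p, d u v ≤ d u p + d p v) (d_nonneg : ∀ u v, 0 ≤ d u v)
    (pay_symm : ∀ u v, pay u v = pay v u)
    (hpay : ∀ u v, u ≠ v → Q u v → SurplusBound (d u v) (pay u v)) (S : Finset V) :
    ∃ f : V → V, (∀ u ∈ S, f u ∈ S) ∧
      (∀ u ∈ S, ∀ v ∈ S, f u = f v → Q u v ∧ d u v ≤ 4 / 5) ∧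
      0 ≤ ∑ u ∈ S, ∑ v ∈ S, if Q u v ∧ f u ≠ f v then pay u v else 0 := by
  induction S using Finset.strongInduction with
  | H S ih =>
    rcases S.eq_empty_or_nonempty with rfl | ⟨p, hp⟩
    · exact ⟨id, by simp⟩
    obtain ⟨B, hBS, hpB, hdiam, hcross⟩ :=
      exists_cluster Q hQ d pay d_self d_symm d_tri d_nonneg hpay S p hp
    obtain ⟨g, hgmem, hgdiam, hgsum⟩ := ih (S \ B) (Finset.sdiff_ssubset hBS ⟨p, hpB⟩)
    have hne : ∀ v ∈ S \ B, g v ≠ p := fun v hv h =>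
      (Finset.mem_sdiff.1 (hgmem v hv)).2 (h ▸ hpB)
    have hfB : ∀ v ∈ B, (if v ∈ B then p else g v) = p := fun v hv => if_pos hv
    have hfS : ∀ v ∈ S \ B, (if v ∈ B then p else g v) = g v := fun v hv =>
      if_neg (Finset.mem_sdiff.1 hv).2
    refine ⟨fun v => if v ∈ B then p else g v, ?_, ?_, ?_⟩
    · intro u hu
      by_cases h : u ∈ B
      · simpa [h] using hp
      · simpa [h] using (Finset.mem_sdiff.1 (hgmem u (Finset.mem_sdiff.2 ⟨hu, h⟩))).1
    · intro u hu v hv huv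
      by_cases hub : u ∈ B <;> by_cases hvb : v ∈ B
      · exact hdiam u hub v hvb
      · simp only [hub, hvb, if_true, if_false] at huv
        exact absurd huv.symm (hne v (Finset.mem_sdiff.2 ⟨hv, hvb⟩))
      · simp only [hub, hvb, if_true, if_false] at huv
        exact absurd huv (hne u (Finset.mem_sdiff.2 ⟨hu, hub⟩))
      · simp only [hub, hvb, if_false] at huv
        exact hgdiam u (Finset.mem_sdiff.2 ⟨hu, hub⟩) v (Finset.mem_sdiff.2 ⟨hv, hvb⟩) huv
    · set F : V → V → ℝ := fun u v =>
        if Q u v ∧ (if u ∈ B then p else g u) ≠ (if v ∈ B then p else g v)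
        then pay u v else 0 with hF
      have hSS : ∑ u ∈ S \ B, ∑ v ∈ S \ B, F u v =
          ∑ u ∈ S \ B, ∑ v ∈ S \ B, if Q u v ∧ g u ≠ g v then pay u v else 0 := by
        refine Finset.sum_congr rfl fun u hu => Finset.sum_congr rfl fun v hv => ?_
        simp only [hF, hfS u hu, hfS v hv]
      have hBSB : ∑ u ∈ B, ∑ v ∈ S \ B, F u v =
          ∑ v ∈ B, ∑ w ∈ S \ B, if Q v w then pay v w else 0 := by
        refine Finset.sum_congr rfl fun u hu => Finset.sum_congr rfl fun v hv => ?_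
        simp only [hF, hfB u hu, hfS v hv, ne_eq, (hne v hv).symm, not_false_eq_true, and_true]
      have hSBB : ∑ u ∈ S \ B, ∑ v ∈ B, F u v = ∑ u ∈ B, ∑ v ∈ S \ B, F u v := by
        rw [Finset.sum_comm]
        refine Finset.sum_congr rfl fun u _ => Finset.sum_congr rfl fun v _ => ?_
        have hiff : Q u v ↔ Q v u := ⟨hQ.symm, hQ.symm⟩
        simp only [hF, hiff, pay_symm u v, ne_comm]
      have hBB : ∑ u ∈ B, ∑ v ∈ B, F u v = 0 := by
        refine Finset.sum_eq_zero fun u hu => Finset.sum_eq_zero fun v hv => ?_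
        simp only [hF, hfB u hu, hfB v hv, ne_eq, not_true_eq_false, and_false, if_false]
      have hsplit : ∑ u ∈ S, ∑ v ∈ S, F u v =
          (∑ u ∈ S \ B, ∑ v ∈ S \ B, F u v + ∑ u ∈ S \ B, ∑ v ∈ B, F u v) +
            (∑ u ∈ B, ∑ v ∈ S \ B, F u v + ∑ u ∈ B, ∑ v ∈ B, F u v) := by
        simp only [← Finset.sum_add_distrib, Finset.sum_sdiff hBS]
      change 0 ≤ ∑ u ∈ S, ∑ v ∈ S, F u v
      rw [hsplit, hSBB, hBB, hBSB, hSS]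
      linarith

/-- Every partition `Q` has a refinement `R` into clusters of diameter at most `4/5` such that the
newly separated pairs leave a nonnegative total surplus. -/
lemma exists_refinement {V : Type*} [Fintype V] (Q : V → V → Prop) (hQ : Equivalence Q)
    (d pay : V → V → ℝ) (d_self : ∀ u, d u u = 0) (d_symm : ∀ u v, d u v = d v u)
    (d_tri : ∀ u v p, d u v ≤ d u p + d p v) (d_nonneg : ∀ u v, 0 ≤ d u v)
    (pay_symm : ∀ u v, pay u v = pay v u)
    (hpay : ∀ u v, u ≠ v → Q u v → SurplusBound (d u v) (pay u v)) :
    ∃ R : V → V → Prop, Equivalence R ∧ (∀ u v, R u v → Q u v) ∧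
      (∀ u v, R u v → d u v ≤ 4 / 5) ∧
      0 ≤ ∑ u, ∑ v, if Q u v ∧ ¬ R u v then pay u v else 0 := by
  obtain ⟨f, -, hf, hsum⟩ := exists_clustering_on Q hQ d pay d_self d_symm d_tri d_nonneg
    pay_symm hpay Finset.univ
  refine ⟨fun u v => f u = f v, ⟨fun _ => rfl, Eq.symm, Eq.trans⟩,
    fun u v h => (hf u (Finset.mem_univ _) v (Finset.mem_univ _) h).1,
    fun u v h => (hf u (Finset.mem_univ _) v (Finset.mem_univ _) h).2, ?_⟩
  convert hsum

lemma sum_sum_mk_eq_two_mul {V : Type*} [Fintype V] [DecidableEq V] (g : Sym2 V → ℝ)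
    (hg : ∀ e, e.IsDiag → g e = 0) :
    ∑ u, ∑ v, g s(u, v) = 2 * ∑ e with ¬ e.IsDiag, g e := by
  rw [← Fintype.sum_prod_type' (f := fun u v => g s(u, v)), Finset.sum_filter_of_ne
    (p := fun e : Sym2 V => ¬ e.IsDiag) (fun e _ he hd => he (hg e hd)), Finset.mul_sum,
    ← Finset.sum_fiberwise (g := fun q : V × V => s(q.1, q.2))]
  refine Finset.sum_congr rfl fun e _ => ?_
  rw [Finset.sum_congr rfl (g := fun _ => g e) fun q hq => by rw [(Finset.mem_filter.1 hq).2],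
    Finset.sum_const]
  by_cases hd : e.IsDiag
  · simp [hg e hd]
  · induction e with
    | h a b =>
      rw [Sym2.mk_isDiag_iff] at hd
      have : (Finset.univ.filter fun q : V × V => s(q.1, q.2) = s(a, b)) = {(a, b), (b, a)} := by
        ext ⟨c, d⟩
        simp
      rw [this, Finset.card_pair (by simp [hd]), nsmul_eq_mul, Nat.cast_ofNat]

lemma pairTogether_mk_iff {V : Type*} {R : V → V → Prop} (hR : Equivalence R) (u v : V) :
    PairTogether R s(u, v) ↔ R u v := by
  constructor
  · rintro ⟨a, b, hab, h⟩
    rcases Sym2.eq_iff.1 hab with ⟨rfl, rfl⟩ | ⟨rfl, rfl⟩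
    · exact h
    · exact hR.symm h
  · exact fun h => ⟨u, v, rfl, h⟩

/-- Splitting the final account of a pair according to its top-most separation layer. -/
lemma sum_account_eq (ℓ : ℕ) (hℓ : 1 ≤ ℓ) (P : ℕ → Prop) (htop : P (ℓ + 1))
    (hmono : ∀ t ∈ Finset.Icc 1 ℓ, P t → P (t + 1)) (τ : ℕ) (hτ : 1 ≤ τ) (c : ℝ) :
    c - (if sSup {t | t ∈ Finset.Icc 1 ℓ ∧ ¬ P t} ≠ τ then 1 else 0) =
      (∑ t ∈ Finset.Icc 1 ℓ, if P (t + 1) ∧ ¬ P t then c - (if t ≠ τ then 1 else 0) else 0) +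
        if P 1 then c - 1 else 0 := by
  have hup : ∀ s, 1 ≤ s → P s → ∀ t, s ≤ t → t ≤ ℓ + 1 → P t := by
    intro s hs hPs t hst
    induction t, hst using Nat.le_induction with
    | base => exact fun _ => hPs
    | succ t hst ih =>
      exact fun ht => hmono t (Finset.mem_Icc.2 ⟨hs.trans hst, by omega⟩) (ih (by omega))
  by_cases h1 : P 1
  · have hall : ∀ t ∈ Finset.Icc 1 ℓ, P t := fun t ht => by
      rw [Finset.mem_Icc] at ht
      exact hup 1 le_rfl h1 t ht.1 (by omega)
    have hempty : {t | t ∈ Finset.Icc 1 ℓ ∧ ¬ P t} = ∅ :=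
      Set.eq_empty_of_forall_notMem fun t ht => ht.2 (hall t ht.1)
    rw [Finset.sum_eq_zero fun t ht => if_neg fun h => h.2 (hall t ht), hempty, csSup_empty,
      if_pos h1, if_pos (by simp; omega), zero_add]
  · set A := {t | t ∈ Finset.Icc 1 ℓ ∧ ¬ P t} with hA
    have hbdd : BddAbove A := ⟨ℓ, fun t ht => (Finset.mem_Icc.1 ht.1).2⟩
    have hmem : sSup A ∈ A := Nat.sSup_mem ⟨1, Finset.mem_Icc.2 ⟨le_rfl, hℓ⟩, h1⟩ hbdd
    set s := sSup A with hs
    have hmem' := Finset.mem_Icc.1 hmem.1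
    have hafter : ∀ t, s < t → t ≤ ℓ → P t := by
      intro t hst ht
      by_contra hcon
      exact absurd (le_csSup hbdd (show t ∈ A from ⟨Finset.mem_Icc.2 ⟨by omega, ht⟩, hcon⟩))
        (not_le.2 hst)
    have hnext : P (s + 1) := by
      rcases hmem'.2.lt_or_eq with h | h
      · exact hafter _ (Nat.lt_succ_self s) h
      · rwa [h]
    rw [if_neg h1, add_zero, Finset.sum_eq_single_of_mem s hmem.1]
    · rw [if_pos (c := P (s + 1) ∧ ¬ P s) ⟨hnext, hmem.2⟩]
    · intro t ht hts
      rw [Finset.mem_Icc] at ht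
      refine if_neg fun h => ?_
      rcases lt_or_gt_of_ne hts with hlt | hlt
      · exact hmem.2 (hup (t + 1) (by omega) h.1 s hlt (by omega))
      · exact h.2 (hafter t hlt ht.2)

namespace LPL0Feasible

variable {V : Type*} {ℓ : ℕ} {x : ℕ → Sym2 V → ℝ}

lemma antitone (hx : LPL0Feasible ℓ x) {s t : ℕ} (hs : 1 ≤ s) (hst : s ≤ t) (ht : t ≤ ℓ + 1)
    (e : Sym2 V) : x t e ≤ x s e := by
  induction t, hst using Nat.le_induction with
  | base => exact le_rfl
  | succ t hst ih =>
    refine le_trans ?_ (ih (by omega))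
    rcases Nat.lt_or_ge t ℓ with h | h
    · exact hx.2.2.2.1 t (by omega) h e
    · obtain rfl : t = ℓ := by omega
      rw [hx.2.2.2.2 e]
      exact (hx.2.2.1 t (Finset.mem_Icc.2 ⟨by omega, le_rfl⟩) e).1

lemma nonneg (hx : LPL0Feasible ℓ x) {t : ℕ} (h1 : 1 ≤ t) (ht : t ≤ ℓ + 1) (e : Sym2 V) :
    0 ≤ x t e :=
  (hx.2.2.2.2 e).ge.trans (hx.antitone h1 ht le_rfl e)

/-- Separating at layer `t` a pair that is together at layer `t + 1` leaves a surplus. -/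
lemma surplusBound (hx : LPL0Feasible ℓ x) {t τ : ℕ} (ht : t ∈ Finset.Icc 1 ℓ)
    (hτ : τ ∈ Finset.Icc 1 ℓ) (e : Sym2 V) (hdiam : x (t + 1) e ≤ 4 / 5) :
    SurplusBound (x t e) (5 * ((1 - x τ e) + x (τ + 1) e) - if t ≠ τ then 1 else 0) := by
  have hx1 := (hx.2.2.1 τ hτ e).2
  rw [Finset.mem_Icc] at ht hτ
  have hn := hx.nonneg (t := τ + 1) (by omega) (by omega) e
  rcases lt_trichotomy τ t with h | rfl | h
  · left
    rw [if_pos (by omega)]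
    linarith [hx.antitone (s := τ + 1) (t := t) (by omega) h (by omega) e]
  · right
    rw [if_neg (by simp)]
    constructor <;> linarith
  · right
    rw [if_pos (by omega)]
    have h1 := hx.antitone (s := t + 1) (t := τ) (by omega) h (by omega) e
    have h2 := hx.antitone (s := t) (t := τ) (by omega) h.le (by omega) e
    constructor <;> linarith

end LPL0Feasible

/-- A consistent collection of partitions obtained by rounding `x` one layer at a time. -/
lemma exists_hierarchy {V : Type*} [Fintype V] {ℓ : ℕ} (tlay : Sym2 V → ℕ)
    (htrange : ∀ e : Sym2 V, ¬ e.IsDiag → tlay e ∈ Finset.Icc 1 ℓ)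
    {x : ℕ → Sym2 V → ℝ} (hx : LPL0Feasible ℓ x) :
    ∃ R : ℕ → V → V → Prop, (∀ u v, R (ℓ + 1) u v) ∧
      (∀ t ∈ Finset.Icc 1 (ℓ + 1), Equivalence (R t) ∧ ∀ u v, R t u v → x t s(u, v) ≤ 4 / 5) ∧
      ∀ t ∈ Finset.Icc 1 ℓ, (∀ u v, R t u v → R (t + 1) u v) ∧
        0 ≤ ∑ u, ∑ v, if R (t + 1) u v ∧ ¬ R t u v then
          5 * ((1 - x (tlay s(u, v)) s(u, v)) + x (tlay s(u, v) + 1) s(u, v)) -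
            (if t ≠ tlay s(u, v) then 1 else 0) else 0 := by
  have step : ∀ (t : ℕ) (Q : V → V → Prop), ∃ R : V → V → Prop, t ∈ Finset.Icc 1 ℓ →
      (Equivalence Q ∧ ∀ u v, Q u v → x (t + 1) s(u, v) ≤ 4 / 5) →
      (Equivalence R ∧ ∀ u v, R u v → x t s(u, v) ≤ 4 / 5) ∧ (∀ u v, R u v → Q u v) ∧
        0 ≤ ∑ u, ∑ v, if Q u v ∧ ¬ R u v then
          5 * ((1 - x (tlay s(u, v)) s(u, v)) + x (tlay s(u, v) + 1) s(u, v)) -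
            (if t ≠ tlay s(u, v) then 1 else 0) else 0 := by
    intro t Q
    by_cases h : t ∈ Finset.Icc 1 ℓ ∧
      (Equivalence Q ∧ ∀ u v, Q u v → x (t + 1) s(u, v) ≤ 4 / 5)
    · obtain ⟨ht, hQ, hdiam⟩ := h
      obtain ⟨R, h1, h2, h3, h4⟩ := exists_refinement Q hQ (fun u v => x t s(u, v))
        (fun u v => 5 * ((1 - x (tlay s(u, v)) s(u, v)) + x (tlay s(u, v) + 1) s(u, v)) -
            (if t ≠ tlay s(u, v) then 1 else 0))
        (hx.1 t ht) (fun u v => by rw [Sym2.eq_swap]) (hx.2.1 t ht)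
        (fun u v => (hx.2.2.1 t ht _).1) (fun u v => by rw [Sym2.eq_swap])
        (fun u v huv hQuv => hx.surplusBound ht
          (htrange _ (by rwa [Sym2.mk_isDiag_iff])) _ (hdiam u v hQuv))
      exact ⟨R, fun _ _ => ⟨⟨h1, h3⟩, h2, h4⟩⟩
    · exact ⟨Q, fun h1 h2 => absurd ⟨h1, h2⟩ h⟩
  choose F hF using step
  set G : ℕ → V → V → Prop := fun k =>
    Nat.rec (fun _ _ => True) (fun k Q => F (ℓ - k) Q) k with hG
  have hsucc : ∀ t ∈ Finset.Icc 1 ℓ, G (ℓ + 1 - t) = F t (G (ℓ + 1 - (t + 1))) := by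
    intro t ht
    rw [Finset.mem_Icc] at ht
    obtain ⟨k, rfl⟩ := Nat.exists_eq_add_of_le ht.2
    have e1 : t + k + 1 - t = k + 1 := by omega
    have e2 : t + k + 1 - (t + 1) = k := by omega
    rw [e1, e2]
    change F (t + k - k) (G k) = _
    rw [Nat.add_sub_cancel]
  have hgood : ∀ t, t ≤ ℓ + 1 → 1 ≤ t → Equivalence (G (ℓ + 1 - t)) ∧
      ∀ u v, G (ℓ + 1 - t) u v → x t s(u, v) ≤ 4 / 5 := by
    intro t ht
    induction ht using Nat.decreasingInduction with
    | self =>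
      intro _
      rw [Nat.sub_self]
      refine ⟨⟨fun _ => trivial, fun _ => trivial, fun _ _ => trivial⟩, fun u v _ => ?_⟩
      rw [hx.2.2.2.2]
      norm_num
    | of_succ t ht ih =>
      intro h1
      have hmem : t ∈ Finset.Icc 1 ℓ := Finset.mem_Icc.2 ⟨h1, by omega⟩
      rw [hsucc t hmem]
      exact (hF t _ hmem (ih (by omega))).1
  refine ⟨fun t => G (ℓ + 1 - t), fun u v => ?_, fun t ht => ?_, fun t ht => ?_⟩
  · simp [hG]
  · rw [Finset.mem_Icc] at ht
    exact hgood t ht.2 ht.1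
  · have := (hF t _ ht (hgood (t + 1) (by rw [Finset.mem_Icc] at ht; omega) (by omega))).2
    simp only [hsucc t ht]
    exact this

/-- Every feasible solution of LP-(L0) can be rounded to a consistent collection of partitions at
the loss of a factor `5`. -/
lemma exists_rounding_s1 {V : Type*} [Fintype V] [DecidableEq V] {ℓ : ℕ} (hℓ : 1 ≤ ℓ)
    (tlay : Sym2 V → ℕ) (htrange : ∀ e : Sym2 V, ¬ e.IsDiag → tlay e ∈ Finset.Icc 1 ℓ)
    {x : ℕ → Sym2 V → ℝ} (hx : LPL0Feasible ℓ x) :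
    ∃ R : ℕ → V → V → Prop,
      (∀ t ∈ Finset.Icc 1 ℓ, Equivalence (R t)) ∧
      (∀ t, 1 ≤ t → t < ℓ → ∀ u v, R t u v → R (t + 1) u v) ∧
      (({e : Sym2 V | ¬ e.IsDiag ∧
        sSup {t | t ∈ Finset.Icc 1 ℓ ∧ ¬ PairTogether (R t) e} ≠ tlay e}).ncard : ℝ)
          ≤ 5 * LPL0Val tlay x := by
  obtain ⟨R, htop, hgood, hstep⟩ := exists_hierarchy tlay htrange hx
  have hequiv : ∀ t ∈ Finset.Icc 1 ℓ, Equivalence (R t) := fun t ht =>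
    (hgood t (Finset.Icc_subset_Icc_right (Nat.le_succ ℓ) ht)).1
  refine ⟨R, hequiv, fun t h1 h2 => (hstep t (Finset.mem_Icc.2 ⟨h1, h2.le⟩)).1, ?_⟩
  set c : Sym2 V → ℝ := fun e => 5 * ((1 - x (tlay e) e) + x (tlay e + 1) e) with hc
  set err : Sym2 V → ℝ := fun e =>
    if sSup {t | t ∈ Finset.Icc 1 ℓ ∧ ¬ PairTogether (R t) e} ≠ tlay e then 1 else 0 with herr
  have hcard : (({e : Sym2 V | ¬ e.IsDiag ∧
      sSup {t | t ∈ Finset.Icc 1 ℓ ∧ ¬ PairTogether (R t) e} ≠ tlay e}).ncard : ℝ) =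
        ∑ e with ¬ e.IsDiag, err e := by
    rw [herr, Finset.sum_boole, Finset.filter_filter, ← Set.ncard_coe_finset]
    simp
  have hval : 5 * LPL0Val tlay x = ∑ e with ¬ e.IsDiag, c e := by
    rw [LPL0Val, Finset.mul_sum]
  rw [hcard, hval, ← sub_nonneg, ← Finset.sum_sub_distrib]
  set g : Sym2 V → ℝ := fun e => if e.IsDiag then 0 else c e - err e with hg
  have hpair : ∀ u v : V, (∑ t ∈ Finset.Icc 1 ℓ, if R (t + 1) u v ∧ ¬ R t u v then
      c s(u, v) - (if t ≠ tlay s(u, v) then 1 else 0) else 0) ≤ g s(u, v) := by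
    intro u v
    rcases eq_or_ne u v with rfl | huv
    · rw [Finset.sum_eq_zero fun t ht => if_neg fun h => h.2 ((hequiv t ht).refl u)]
      simp [hg]
    · have hdiag : ¬ (s(u, v) : Sym2 V).IsDiag := by rwa [Sym2.mk_isDiag_iff]
      have hτ := htrange _ hdiag
      have hset : {t | t ∈ Finset.Icc 1 ℓ ∧ ¬ PairTogether (R t) s(u, v)} =
          {t | t ∈ Finset.Icc 1 ℓ ∧ ¬ R t u v} := by
        ext t
        exact and_congr_right fun ht => by rw [pairTogether_mk_iff (hequiv t ht)]
      simp only [hg, if_neg hdiag, herr, hset]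
      rw [sum_account_eq ℓ hℓ (fun t => R t u v) (htop u v) (fun t ht => (hstep t ht).1 u v)
        _ (Finset.mem_Icc.1 hτ).1 (c s(u, v))]
      refine le_add_of_nonneg_right ?_
      split_ifs with h1
      · have hd := (hgood 1 (Finset.mem_Icc.2 ⟨le_rfl, by omega⟩)).2 u v h1
        rw [Finset.mem_Icc] at hτ
        have ha := hx.antitone le_rfl hτ.1 (by omega) s(u, v)
        have hn := hx.nonneg (t := tlay s(u, v) + 1) (by omega) (by omega) s(u, v)
        simp only [hc]
        linarith
      · exact le_rfl
  have htotal : 0 ≤ ∑ u, ∑ v, g s(u, v) := by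
    refine le_trans ?_ (Finset.sum_le_sum fun u _ => Finset.sum_le_sum fun v _ => hpair u v)
    rw [Finset.sum_congr rfl fun u _ => Finset.sum_comm, Finset.sum_comm]
    exact Finset.sum_nonneg fun t ht => (hstep t ht).2
  rw [sum_sum_mk_eq_two_mul g fun e he => if_pos he] at htotal
  rw [Finset.sum_congr rfl (g := g) fun e he => (if_neg (Finset.mem_filter.1 he).2).symm]
  linarith

/-- 5-approximation for the ultrametric violation distance problem: for every
assignment `tlay` of a layer in `{1,…,ℓ}` to each unordered pair of distinct
elements of a finite set `V`, there is a consistent collection of partitions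
(encoded as equivalence relations `R t`, layer `t` refining layer `t+1`)
such that the number of pairs whose top-most separation layer
`t* = sSup {t ∈ [1,ℓ] : the pair is separated at layer t}` (equal to `0` if the
pair is never separated) differs from the assigned layer is at most `5` times
the objective value of every feasible solution of LP-(L0), hence at most `5`
times the LP minimum. -/
theorem stmt1 (V : Type*) [Fintype V] [DecidableEq V]
    (ℓ : ℕ) (hℓ : 1 ≤ ℓ)
    (tlay : Sym2 V → ℕ)
    (htrange : ∀ e : Sym2 V, ¬ e.IsDiag → tlay e ∈ Finset.Icc 1 ℓ) :
    ∃ R : ℕ → V → V → Prop,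
      (∀ t ∈ Finset.Icc 1 ℓ, Equivalence (R t)) ∧
      (∀ t, 1 ≤ t → t < ℓ → ∀ u v, R t u v → R (t + 1) u v) ∧
      (∀ x : ℕ → Sym2 V → ℝ, LPL0Feasible ℓ x →
        (({e : Sym2 V | ¬ e.IsDiag ∧
            sSup {t | t ∈ Finset.Icc 1 ℓ ∧ ¬ PairTogether (R t) e} ≠ tlay e}).ncard : ℝ)
          ≤ 5 * LPL0Val tlay x) := by
  set err : (ℕ → V → V → Prop) → ℕ := fun R => ({e : Sym2 V | ¬ e.IsDiag ∧
    sSup {t | t ∈ Finset.Icc 1 ℓ ∧ ¬ PairTogether (R t) e} ≠ tlay e}).ncard with herr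
  set A : Set (ℕ → V → V → Prop) := {R | (∀ t ∈ Finset.Icc 1 ℓ, Equivalence (R t)) ∧
    ∀ t, 1 ≤ t → t < ℓ → ∀ u v, R t u v → R (t + 1) u v} with hA
  have hne : A.Nonempty :=
    ⟨fun _ => Eq, fun _ _ => eq_equivalence, fun _ _ _ _ _ h => h⟩
  obtain ⟨R, hR, hmin⟩ := exists_minimalFor_of_wellFoundedLT (· ∈ A) err hne
  refine ⟨R, hR.1, hR.2, fun x hx => ?_⟩
  obtain ⟨R', h1, h2, h3⟩ := exists_rounding_s1 hℓ tlay htrange hx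
  refine le_trans ?_ h3
  have hle : err R ≤ err R' := (le_total (err R) (err R')).elim id (hmin ⟨h1, h2⟩)
  exact_mod_cast hle
end
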